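/- Let κ be a field of characteristic 0, let q ∈ κ[y] and p ∈ κ[y,z] be polynomials generating the unit ideal of κ[y,z], and let ∂ = q(y) ∂_z + p(y,z) ∂_u be the corresponding fixed point free triangular κ-derivation of B = κ[y,z,u]. Then the generated G_a-action is a translation with quotient A²_κ: there exists s ∈ B with ∂s = 1, the kernel ker ∂ is κ-isomorphic to a polynomial ring in two variables over κ, and the κ-algebra homomorphism (ker ∂)[S] → B, S ↦ s, restricting to the inclusion on ker ∂, is an isomorphism. -/

import Mathlib

/- STATEMENT 17: A fixed point free triangular derivation q(y)∂_z + p(y,z)∂_u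
of κ[y,z,u] over a field κ of characteristic 0 generates a translation with
quotient A²_κ. -/

open MvPolynomial

/-- The kernel of a derivation, as a subalgebra. -/
def kerDer {R B : Type*} [CommRing R] [CommRing B] [Algebra R B]
    (D : Derivation R B B) : Subalgebra R B where
  carrier := {b | D b = 0}
  add_mem' := by
    intro a b ha hb
    simp only [Set.mem_setOf_eq] at ha hb ⊢
    rw [map_add, ha, hb, add_zero]
  mul_mem' := by
    intro a b ha hb
    simp only [Set.mem_setOf_eq] at ha hb ⊢
    rw [D.leibniz, ha, hb, smul_zero, smul_zero, add_zero]
  algebraMap_mem' := by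
    intro r
    show D (algebraMap R B r) = 0
    simp

/-- A surjective endomorphism of a Noetherian commutative ring is injective. -/
theorem RingHom.injective_of_surjective_of_isNoetherianRing {A : Type*} [CommRing A]
    [IsNoetherianRing A] (f : A →+* A) (hf : Function.Surjective f) : Function.Injective f := by
  have hmono : Monotone fun n => RingHom.ker (f ^ n) := monotone_nat_of_le_succ fun n a ha => by
    rw [RingHom.mem_ker] at ha ⊢
    rw [pow_succ', RingHom.mul_def, RingHom.comp_apply, ha, map_zero]
  obtain ⟨n, hn⟩ := monotone_stabilizes_iff_noetherian.2 ‹IsNoetherianRing A› ⟨_, hmono⟩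
  refine (injective_iff_map_eq_zero f).2 fun a ha => ?_
  obtain ⟨b, rfl⟩ : ∃ b, (f ^ n) b = a := by
    rw [RingHom.coe_pow]
    exact hf.iterate n a
  have hb : b ∈ RingHom.ker (f ^ (n + 1)) := by
    rw [RingHom.mem_ker, pow_succ', RingHom.mul_def, RingHom.comp_apply, ha]
  rw [← RingHom.mem_ker]
  exact (hn (n + 1) n.le_succ).ge hb

theorem Derivation.eval₂_of_forall_eq_zero {κ R B : Type*} [CommRing κ] [CommRing R]
    [CommRing B] [Algebra κ B] (D : Derivation κ B B) (f : R →+* B) (hf : ∀ r, D (f r) = 0)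
    (x : B) (a : Polynomial R) :
    D (a.eval₂ f x) = a.derivative.eval₂ f x * D x := by
  induction a using Polynomial.induction_on' with
  | add a b ha hb => simp only [Polynomial.eval₂_add, map_add, ha, hb, add_mul]
  | monomial n r =>
    simp [Polynomial.eval₂_monomial, Polynomial.derivative_monomial, Derivation.leibniz, hf,
      Derivation.leibniz_pow]
    ring

/-- If `κ[y, z, u]` is generated by `v`, `f`, `s` with `D v = D f = 0` and `D s = 1`, then `D` is
the partial derivative `∂/∂s` in the coordinates `v, f, s`. -/
theorem kerDer_equiv_and_bijective_aeval {κ : Type*} [Field κ] [CharZero κ]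
    (D : Derivation κ (MvPolynomial (Fin 3) κ) (MvPolynomial (Fin 3) κ))
    {v f s : MvPolynomial (Fin 3) κ} (hv : D v = 0) (hf : D f = 0) (hs : D s = 1)
    (hgen : Algebra.adjoin κ {v, f, s} = ⊤) :
    Nonempty (↥(kerDer D) ≃ₐ[κ] MvPolynomial (Fin 2) κ) ∧
      Function.Bijective (Polynomial.aeval (R := ↥(kerDer D)) s) := by
  have hmem : ∀ b, b ∈ kerDer D ↔ D b = 0 := fun b => Iff.rfl
  let g : MvPolynomial (Fin 2) κ →ₐ[κ] kerDer D := MvPolynomial.aeval ![⟨v, hv⟩, ⟨f, hf⟩]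
  let e : Polynomial (MvPolynomial (Fin 2) κ) →+* MvPolynomial (Fin 3) κ :=
    Polynomial.eval₂RingHom ((kerDer D).val.comp g).toRingHom s
  have he : ∀ a, e a = Polynomial.aeval s (a.map g.toRingHom) := fun a => by
    simp only [e, Polynomial.aeval_def, Polynomial.eval₂_map, Polynomial.coe_eval₂RingHom]
    rfl
  have heC : ∀ a, e (Polynomial.C a) = g a := fun a => by simp [e]
  have hsurj : Function.Surjective e := by
    have : Algebra.adjoin κ {v, f, s} ≤ (Polynomial.aeval (R := kerDer D) s
      |>.restrictScalars κ |>.comp (Polynomial.mapAlgHom g)).range := by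
      rw [Algebra.adjoin_le_iff]
      rintro _ (rfl | rfl | rfl)
      · exact ⟨.C (X 0), by simp [g]⟩
      · exact ⟨.C (X 1), by simp [g]⟩
      · exact ⟨.X, by simp⟩
    intro b
    obtain ⟨a, ha⟩ := this (hgen ▸ Algebra.mem_top : b ∈ _)
    exact ⟨a, (he a).trans ha⟩
  have hinj : Function.Injective e := by
    let ε := (MvPolynomial.finSuccEquiv κ 2).toRingEquiv
    have h1 : Function.Injective (e.comp (ε : _ →+* _)) :=
      RingHom.injective_of_surjective_of_isNoetherianRing _ (hsurj.comp ε.surjective)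
    exact fun a b hab => ε.symm.injective (h1 (by simpa using hab))
  have hD : ∀ a, D (e a) = e a.derivative := fun a => by
    have := D.eval₂_of_forall_eq_zero ((kerDer D).val.comp g).toRingHom (fun r => (g r).2) s a
    rwa [hs, mul_one] at this
  have hg : Function.Bijective g := by
    refine ⟨fun a b hab => Polynomial.C_injective (hinj ?_), fun ⟨b, hb⟩ => ?_⟩
    · rw [heC, heC, hab]
    · obtain ⟨a, rfl⟩ := hsurj b
      rw [hmem, hD, map_eq_zero_iff e hinj] at hb
      refine ⟨a.coeff 0, Subtype.ext ?_⟩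
      rw [← heC, ← Polynomial.eq_C_of_derivative_eq_zero hb]
  refine ⟨⟨(AlgEquiv.ofBijective g hg).symm⟩, ?_⟩
  have hmap : Function.Bijective (Polynomial.map g.toRingHom) :=
    ⟨Polynomial.map_injective _ hg.1, Polynomial.map_surjective _ hg.2⟩
  have hcomp : Polynomial.aeval s ∘ Polynomial.map g.toRingHom = e :=
    _root_.funext fun a => (he a).symm
  exact (Function.Bijective.of_comp_iff _ hmap).1 (hcomp ▸ ⟨hinj, hsurj⟩)

theorem Polynomial.exists_derivative_eq (κ : Type*) {R : Type*} [CommRing R] [Field κ]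
    [CharZero κ] [Algebra κ R]
    (p : Polynomial R) : ∃ P : Polynomial R, Polynomial.derivative P = p := by
  induction p using Polynomial.induction_on' with
  | add a b ha hb =>
    obtain ⟨P, rfl⟩ := ha
    obtain ⟨Q, rfl⟩ := hb
    exact ⟨P + Q, map_add _ _ _⟩
  | monomial n a =>
    refine ⟨Polynomial.monomial (n + 1) (((n + 1 : κ)⁻¹) • a), ?_⟩
    have : ((n : κ) + 1) ≠ 0 := Nat.cast_add_one_ne_zero n
    rw [Polynomial.derivative_monomial, Nat.add_sub_cancel, smul_mul_assoc]
    congr 1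
    rw [← nsmul_eq_mul', ← Nat.cast_smul_eq_nsmul κ, smul_smul]
    push_cast
    rw [inv_mul_cancel₀ this, one_smul]

/-- A polynomial without constant term whose derivative is a unit has a compositional inverse,
over a Noetherian algebra over a field of characteristic zero. -/
theorem Polynomial.exists_comp_inverse (κ : Type*) {R : Type*} [CommRing R] [Field κ]
    [CharZero κ] [Algebra κ R] [IsNoetherianRing R]
    (P : Polynomial R) (h0 : P.coeff 0 = 0) (hP : IsUnit (Polynomial.derivative P)) :
    ∃ h : Polynomial R, P.comp h = .X ∧ h.comp P = .X := by
  obtain ⟨hu, hn⟩ := Polynomial.isUnit_iff_coeff_isUnit_isNilpotent.1 hP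
  rw [Polynomial.coeff_derivative] at hu
  simp only [zero_add, Nat.cast_zero, mul_one] at hu
  obtain ⟨c, hc⟩ := hu
  have hnil : IsNilpotent (P - Polynomial.C (c : R) * .X) := by
    rw [Polynomial.isNilpotent_iff]
    rintro (_ | _ | n)
    · simp [h0]
    · simp [hc]
    · have h1 := hn (n + 1) n.succ_ne_zero
      rw [Polynomial.coeff_derivative] at h1
      have h2 : IsUnit (((n + 1 : ℕ) : R) + 1) := by
        have h3 : IsUnit ((((n + 1 : ℕ) : κ) + 1)) := (Nat.cast_add_one_ne_zero (n + 1)).isUnit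
        simpa using h3.map (algebraMap κ R)
      rw [h2.isNilpotent_mul_unit_of_commute_iff (Commute.all _ _)] at h1
      simpa [Polynomial.coeff_X] using h1
  let G : Polynomial (Polynomial R) := P.map Polynomial.C - Polynomial.C .X
  have hG : ∀ x : Polynomial R, Polynomial.aeval x G = P.comp x - .X := fun x => by
    simp [G, Polynomial.comp, Polynomial.eval_map]
  have hG' : ∀ x : Polynomial R, Polynomial.aeval x G.derivative = P.derivative.comp x :=
      fun x => by
    simp [G, Polynomial.comp, Polynomial.eval_map, Polynomial.derivative_map]
  obtain ⟨h, ⟨-, hh⟩, -⟩ := Polynomial.existsUnique_nilpotent_sub_and_aeval_eq_zero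
    (P := G) (x := Polynomial.C ((c⁻¹ : Rˣ) : R) * .X)
    (by
      rw [hG]
      convert hnil.map (Polynomial.compRingHom (Polynomial.C ((c⁻¹ : Rˣ) : R) * .X)) using 1
      simp [← mul_assoc, ← Polynomial.C_mul])
    (by
      rw [hG']
      exact hP.map (Polynomial.compRingHom _))
  rw [hG, sub_eq_zero] at hh
  refine ⟨h, hh, ?_⟩
  have hs : Function.Surjective (Polynomial.compRingHom h) := fun a =>
    ⟨a.comp P, by simp [Polynomial.comp_assoc, hh]⟩
  apply RingHom.injective_of_surjective_of_isNoetherianRing _ hs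
  simp [Polynomial.comp_assoc, hh]

/-- A polynomial without constant term whose derivative is a unit modulo `q` has a compositional
inverse modulo `q`. -/
theorem Polynomial.exists_comp_sub_X_dvd (κ : Type*) {R : Type*} [CommRing R] [Field κ]
    [CharZero κ] [Algebra κ R] [IsNoetherianRing R] (q : R) (P : Polynomial R)
    (h0 : P.coeff 0 = 0) (hP : IsCoprime (Polynomial.C q) P.derivative) :
    ∃ h : Polynomial R, Polynomial.C q ∣ P.comp h - .X ∧ Polynomial.C q ∣ h.comp P - .X := by
  let π := Ideal.Quotient.mk (Ideal.span {q})
  have hdvd : ∀ a : Polynomial R, a.map π = 0 → Polynomial.C q ∣ a := fun a ha => by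
    rw [Polynomial.C_dvd_iff_dvd_coeff]
    intro i
    rw [← Ideal.mem_span_singleton, ← Ideal.Quotient.eq_zero_iff_mem]
    simpa using congrArg (·.coeff i) ha
  have hπq : π q = 0 := Ideal.Quotient.eq_zero_iff_mem.2 (Ideal.mem_span_singleton_self q)
  have hunit : IsUnit (P.map π).derivative := by
    have := hP.map (Polynomial.mapRingHom π)
    rwa [Polynomial.coe_mapRingHom, Polynomial.map_C, hπq, Polynomial.C_0, isCoprime_zero_left,
      ← Polynomial.derivative_map] at this
  obtain ⟨h, h₁, h₂⟩ := Polynomial.exists_comp_inverse κ (P.map π) (by simp [h0]) hunit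
  obtain ⟨h, rfl⟩ := Polynomial.map_surjective π Ideal.Quotient.mk_surjective h
  exact ⟨h, hdvd _ (by simp [Polynomial.map_comp, h₁]), hdvd _ (by simp [Polynomial.map_comp, h₂])⟩

/-- With `P = ∫ p dz`, the element `f = P(z) - q u` is invariant; a compositional inverse `h` of `P`
modulo `q` gives a slice `s = (z - h(f)) / q`, and `y, f, s` generate `κ[y, z, u]`. -/
theorem exists_invariant_slice {κ B : Type*} [Field κ] [CharZero κ] [CommRing B] [IsDomain B]
    [Algebra κ B] (D : Derivation κ B B) (y z u : B) (q : Polynomial κ)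
    (p : Polynomial (Polynomial κ)) (hq : Polynomial.aeval y q ≠ 0)
    (hfree : IsCoprime (Polynomial.C q) p) (hy : D y = 0) (hz : D z = Polynomial.aeval y q)
    (hu : D u = p.eval₂ (Polynomial.aeval y : Polynomial κ →ₐ[κ] B).toRingHom z) :
    ∃ f s : B, D f = 0 ∧ D s = 1 ∧ z ∈ Algebra.adjoin κ {y, f, s} ∧
      u ∈ Algebra.adjoin κ {y, f, s} := by
  let ι : Polynomial κ →+* B := (Polynomial.aeval y : Polynomial κ →ₐ[κ] B).toRingHom
  have hιq : ι q ≠ 0 := hq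
  have hDι : ∀ r, D (ι r) = 0 := fun r => by
    have := D.map_aeval r y
    rwa [hy, smul_zero] at this
  obtain ⟨P, hP, h0⟩ : ∃ P : Polynomial (Polynomial κ), P.derivative = p ∧ P.coeff 0 = 0 := by
    obtain ⟨P, hP⟩ := Polynomial.exists_derivative_eq κ p
    exact ⟨P - Polynomial.C (P.coeff 0), by simp [hP], by simp⟩
  obtain ⟨h, ⟨a, ha⟩, ⟨b, hb⟩⟩ := Polynomial.exists_comp_sub_X_dvd κ q P h0 (hP ▸ hfree)
  rw [sub_eq_iff_eq_add] at ha hb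
  have hb' : h.eval₂ ι (P.eval₂ ι z) = ι q * b.eval₂ ι z + z := by
    rw [← Polynomial.eval₂_comp, hb]
    simp
  obtain ⟨k, hk⟩ : ι q * u ∣ h.eval₂ ι (P.eval₂ ι z) - h.eval₂ ι (P.eval₂ ι z - ι q * u) := by
    simpa [Polynomial.eval_map] using
      Polynomial.sub_dvd_eval_sub (P.eval₂ ι z) (P.eval₂ ι z - ι q * u) (h.map ι)
  let f := P.eval₂ ι z - ι q * u
  let s := u * k - b.eval₂ ι z
  have hzs : z = h.eval₂ ι f + ι q * s := by
    linear_combination hk - hb'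
  have hf : D f = 0 := by
    simp only [f, map_sub, D.eval₂_of_forall_eq_zero ι hDι, D.leibniz, hDι, hz, hu, hP,
      smul_eq_mul, mul_zero, add_zero]
    rw [mul_comm]
    exact sub_self _
  have hs : D s = 1 := by
    have := congrArg D hzs
    rw [map_add, D.eval₂_of_forall_eq_zero ι hDι, hf, D.leibniz, hDι, hz] at this
    apply mul_left_cancel₀ hιq
    rw [mul_one]
    simp only [mul_zero, zero_add, smul_eq_mul, add_zero] at this
    exact this.symm
  refine ⟨f, s, hf, hs, ?_⟩
  let S := Algebra.adjoin κ {y, f, s}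
  have hyS : y ∈ S := Algebra.subset_adjoin (by simp)
  have hfS : f ∈ S := Algebra.subset_adjoin (by simp)
  have hsS : s ∈ S := Algebra.subset_adjoin (by simp)
  have hιS : ∀ r, ι r ∈ S := fun r => 
    Algebra.adjoin_mono (by simp) (Polynomial.aeval_mem_adjoin_singleton κ y)
  have hevS : ∀ (c : Polynomial (Polynomial κ)) {x : B}, x ∈ S → c.eval₂ ι x ∈ S :=
    fun c x hx => by
      rw [Polynomial.eval₂_eq_sum]
      exact S.sum_mem fun i _ => S.mul_mem (hιS _) (S.pow_mem hx i)
  have hzS : z ∈ S := hzs ▸ S.add_mem (hevS h hfS) (S.mul_mem (hιS q) hsS)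
  refine ⟨hzS, ?_⟩
  obtain ⟨l, hlS, hl⟩ : ∃ l ∈ S, P.eval₂ ι z - P.eval₂ ι (h.eval₂ ι f) = ι q * s * l := by
    let ιS : Polynomial κ →+* S := ι.codRestrict S hιS
    obtain ⟨l, hl⟩ := Polynomial.sub_dvd_eval_sub ⟨z, hzS⟩ ⟨_, hevS h hfS⟩ (P.map ιS)
    refine ⟨l, l.2, ?_⟩
    have hS : ∀ x : S, (((P.map ιS).eval x : S) : B) = P.eval₂ ι x := fun x => by
      rw [Polynomial.eval_map]
      exact Polynomial.hom_eval₂ P ιS S.val.toRingHom x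
    have := congrArg (Subtype.val : S → B) hl
    rw [S.coe_mul, S.coe_sub, S.coe_sub, hS, hS] at this
    rw [this]
    simp only
    linear_combination l * hzs
  have ha' : P.eval₂ ι (h.eval₂ ι f) = ι q * a.eval₂ ι f + f := by
    rw [← Polynomial.eval₂_comp, ha]
    simp
  have huS : u = a.eval₂ ι f + s * l := by
    apply mul_left_cancel₀ hιq
    linear_combination hl + ha'
  exact huS ▸ S.add_mem (hevS a hfS) (S.mul_mem hsS hlS)

theorem statement17 {κ : Type*} [Field κ] [CharZero κ]
    (q : Polynomial κ) (p : MvPolynomial (Fin 2) κ)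
    -- q(y) and p(y,z) generate the unit ideal of κ[y,z]
    (hfree : Ideal.span ({Polynomial.aeval (X 0 : MvPolynomial (Fin 2) κ) q, p} :
      Set (MvPolynomial (Fin 2) κ)) = ⊤)
    -- the triangular derivation ∂ = q(y) ∂_z + p(y,z) ∂_u  (y = X 0, z = X 1, u = X 2)
    (D : Derivation κ (MvPolynomial (Fin 3) κ) (MvPolynomial (Fin 3) κ))
    (hDy : D (X 0) = 0)
    (hDz : D (X 1) = Polynomial.aeval (X 0 : MvPolynomial (Fin 3) κ) q)
    (hDu : D (X 2) = MvPolynomial.aeval (fun i : Fin 2 =>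
      if i = 0 then (X 0 : MvPolynomial (Fin 3) κ) else X 1) p) :
    -- the action is a translation with quotient A²_κ:
    ∃ s : MvPolynomial (Fin 3) κ, D s = 1 ∧
      Nonempty (↥(kerDer D) ≃ₐ[κ] MvPolynomial (Fin 2) κ) ∧
      Function.Bijective (Polynomial.aeval (R := ↥(kerDer D)) s) := by
  suffices h : ∃ v f s, D v = 0 ∧ D f = 0 ∧ D s = 1 ∧
      ∀ i, (X i : MvPolynomial (Fin 3) κ) ∈ Algebra.adjoin κ {v, f, s} by
    obtain ⟨v, f, s, hv, hf, hs, hgen⟩ := h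
    refine ⟨s, hs, kerDer_equiv_and_bijective_aeval D hv hf hs (top_le_iff.1 ?_)⟩
    rw [← MvPolynomial.adjoin_range_X, Algebra.adjoin_le_iff]
    rintro _ ⟨i, rfl⟩
    exact hgen i
  rcases eq_or_ne q 0 with rfl | hq
  · rw [map_zero, Ideal.span_insert_zero, Ideal.span_singleton_eq_top,
      MvPolynomial.isUnit_iff_eq_C_of_isReduced] at hfree
    obtain ⟨c, hc, rfl⟩ := hfree
    rw [MvPolynomial.aeval_C] at hDu
    refine ⟨X 0, X 1, C c⁻¹ * X 2, hDy, by simpa using hDz, ?_, ?_⟩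
    · simp [D.leibniz, hDu, MvPolynomial.algebraMap_eq, ← C_mul, hc.ne_zero]
    · have h2 : (X 2 : MvPolynomial (Fin 3) κ) = c • (C c⁻¹ * X 2) := by
        rw [smul_eq_C_mul, ← mul_assoc, ← C_mul, mul_inv_cancel₀ hc.ne_zero, C_1, one_mul]
      intro i
      fin_cases i
      · exact Algebra.subset_adjoin (by simp)
      · exact Algebra.subset_adjoin (by simp)
      · change (X 2 : MvPolynomial (Fin 3) κ) ∈ _
        have := Subalgebra.smul_mem _ (Algebra.subset_adjoin (by simp) :
          C c⁻¹ * (X 2 : MvPolynomial (Fin 3) κ) ∈ Algebra.adjoin κ {X 0, X 1, C c⁻¹ * X 2}) c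
        rwa [← h2] at this
  · let θ : MvPolynomial (Fin 2) κ →ₐ[κ] Polynomial (Polynomial κ) :=
      MvPolynomial.aeval ![.C .X, .X]
    let ι : Polynomial κ →ₐ[κ] MvPolynomial (Fin 3) κ := Polynomial.aeval (X 0)
    have hθq : θ (Polynomial.aeval (X 0) q) = .C q := by
      rw [← Polynomial.aeval_algHom_apply]
      simp only [θ, MvPolynomial.aeval_X, Matrix.cons_val_zero]
      have := Polynomial.aeval_algHom_apply (Polynomial.CAlgHom : Polynomial κ →ₐ[κ] _) .X q
      rwa [Polynomial.aeval_X_left_apply] at this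
    have hcop : IsCoprime (Polynomial.C q) (θ p) := by
      obtain ⟨a, b, hab⟩ := Ideal.mem_span_pair.1 (hfree ▸ Submodule.mem_top :
        (1 : MvPolynomial (Fin 2) κ) ∈ Ideal.span {Polynomial.aeval (X 0) q, p})
      refine ⟨θ a, θ b, ?_⟩
      rw [← hθq, ← map_mul, ← map_mul, ← map_add, hab, map_one]
    have hθp : D (X 2) = (θ p).eval₂ ι.toRingHom (X 1) := by
      rw [hDu]
      refine DFunLike.congr_fun (MvPolynomial.ringHom_ext (fun c => ?_) fun i => ?_ :
        RingHomClass.toRingHom (MvPolynomial.aeval _) =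
          (Polynomial.eval₂RingHom ι.toRingHom (X 1)).comp θ.toRingHom) p
      · simp [θ, ι]
      · fin_cases i <;> simp [θ, ι]
    have hq' : Polynomial.aeval (X 0 : MvPolynomial (Fin 3) κ) q ≠ 0 := fun h =>
      hq (transcendental_iff.1 (MvPolynomial.transcendental_X κ 0) q h)
    obtain ⟨f, s, hf, hs, hzS, huS⟩ :=
      exists_invariant_slice D (X 0) (X 1) (X 2) q (θ p) hq' hcop hDy hDz hθp
    refine ⟨X 0, f, s, hDy, hf, hs, fun i => ?_⟩
    fin_cases i
    exacts [Algebra.subset_adjoin (by simp), hzS, huS]
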